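/- arXiv:1507.01211 — 2 statements merged into one kernel-verified Lean document; each statement's English description precedes it below -/
import Mathlib

section
/- Let ψ : ℝ → ℂ be a smooth function supported in [−1/2, 1/2] with ∫_ℝ ψ = 0, and set ψₖ(x) = 2^k ψ(2^k x) for integers k ≥ 0. There exists a constant C (depending only on ψ) with the following property. Let k ≥ 0, and let m, n be integers with k + m ≥ 0 and k + m + n ≥ 0, let F ⊆ ℤ be a finite set, and let f : ℝ → ℂ be bounded and continuous. Define T f = ∑_{μ∈F} 2^{k+m} (∫_ℝ (ψ_{k+m+n} * f)·h_{k+m,μ}) · (ψₖ * h_{k+m,μ}). Then: (a) if m ≥ 0 and n ≥ 0, then for all x ∈ ℝ, |T f(x)| ≤ C · 2^{−m−n} · sup_{|y| ≤ 2^{−k+2}} |f(x+y)|; (b) if m ≤ 0 and n ≥ 0, then for all x ∈ ℝ, |T f(x)| ≤ C · 2^{−n} · sup_{|y| ≤ 2^{−k−m+2}} |f(x+y)|. -/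
open MeasureTheory Real
open scoped ENNReal

noncomputable section

/-- The Haar function $h_{j,\mu}$. -/
def haarFn (j : ℕ) (μ : ℤ) : ℝ → ℂ := fun x =>
  (Set.Ico ((2:ℝ)^(-(j:ℤ)) * μ) ((2:ℝ)^(-(j:ℤ)) * (μ + 1/2))).indicator (fun _ => (1:ℂ)) x
  - (Set.Ico ((2:ℝ)^(-(j:ℤ)) * (μ + 1/2)) ((2:ℝ)^(-(j:ℤ)) * (μ + 1))).indicator (fun _ => (1:ℂ)) x

/-- Convolution $f*g(x)=\int f(t)g(x-t)\,dt$. -/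
def conv (f g : ℝ → ℂ) : ℝ → ℂ := fun x => ∫ t : ℝ, f t * g (x - t)

/-- The dilate $\psi_k(x)=2^k\psi(2^kx)$. -/
def psiDil (ψ : ℝ → ℂ) (k : ℕ) : ℝ → ℂ := fun x => (2:ℂ)^k * ψ ((2:ℝ)^k * x)

/-- The operator $T^k_{m,n}f=\sum_{\mu\in F}2^{k+m}\langle\psi_{k+m+n}*f,h_{k+m,\mu}\rangle\,\psi_k*h_{k+m,\mu}$. -/
def TOp (ψ : ℝ → ℂ) (k : ℕ) (m n : ℤ) (F : Finset ℤ) (f : ℝ → ℂ) : ℝ → ℂ := fun x =>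
  ∑ μ ∈ F, (2:ℂ)^(((k:ℤ) + m).toNat) *
    (∫ y : ℝ, conv (psiDil ψ (((k:ℤ) + m + n).toNat)) f y * haarFn (((k:ℤ) + m).toNat) μ y) *
    conv (psiDil ψ k) (haarFn (((k:ℤ) + m).toNat) μ) x

/-- $\sup_{|y|\le c}|f(x+y)|$. -/
def ballSup (c : ℝ) (f : ℝ → ℂ) (x : ℝ) : ℝ :=
  sSup {t : ℝ | ∃ y : ℝ, |y| ≤ c ∧ t = ‖f (x + y)‖}

/-- The Hardy–Littlewood maximal function $Mf(x)=\sup_{r>0}(2r)^{-1}\int_{x-r}^{x+r}|f|$. -/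
def hlMax (f : ℝ → ℂ) (x : ℝ) : ℝ :=
  sSup {t : ℝ | ∃ r : ℝ, 0 < r ∧ t = (2*r)⁻¹ * ∫ y in Set.Icc (x - r) (x + r), ‖f y‖}

lemma conv_eq_integral_sub (φ g : ℝ → ℂ) (x : ℝ) :
    conv φ g x = ∫ s : ℝ, φ (x - s) * g s := by
  unfold conv
  rw [← integral_sub_left_eq_self (fun t => φ t * g (x - t)) volume x]
  simp

lemma continuous_conv {φ g : ℝ → ℂ} (hφ : Continuous φ) (hc : HasCompactSupport φ)
    (hg : Continuous g) : Continuous (conv φ g) := by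
  have h := hc.continuous_convolution_left (ContinuousLinearMap.mul ℝ ℂ) (μ := volume) hφ
    hg.locallyIntegrable
  exact h

lemma hasCompactSupport_of_support_subset_Icc {φ : ℝ → ℂ} {a b : ℝ}
    (h : Function.support φ ⊆ Set.Icc a b) : HasCompactSupport φ :=
  HasCompactSupport.of_support_subset_isCompact isCompact_Icc h

lemma apply_eq_zero_of_lt_abs {φ : ℝ → ℂ} {δ : ℝ}
    (hs : Function.support φ ⊆ Set.Icc (-δ) δ) {t : ℝ} (ht : δ < |t|) : φ t = 0 := by
  by_contra h
  exact absurd (abs_le.2 (hs h)) (not_le.2 ht)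

/-- The integral of `g` against a Haar function, as a difference of two interval integrals. -/
lemma integral_mul_haarFn {g : ℝ → ℂ} (hg : Continuous g) (j : ℕ) (μ : ℤ) :
    ∫ s : ℝ, g s * haarFn j μ s =
      (∫ s in ((2:ℝ)^(-(j:ℤ)) * μ)..((2:ℝ)^(-(j:ℤ)) * (μ + 1/2)), g s) -
      ∫ s in ((2:ℝ)^(-(j:ℤ)) * (μ + 1/2))..((2:ℝ)^(-(j:ℤ)) * (μ + 1)), g s := by
  have hq : (0:ℝ) < (2:ℝ)^(-(j:ℤ)) := by positivity
  have key : ∀ a b : ℝ, a ≤ b →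
      Integrable ((Set.Ico a b).indicator g) ∧
      ∫ s, (Set.Ico a b).indicator g s = ∫ s in a..b, g s := by
    intro a b hab
    refine ⟨(integrable_indicator_iff measurableSet_Ico).2
      ((hg.integrableOn_Icc).mono_set Set.Ico_subset_Icc_self), ?_⟩
    rw [integral_indicator measurableSet_Ico, intervalIntegral.integral_of_le hab,
      integral_Ico_eq_integral_Ioo, integral_Ioc_eq_integral_Ioo]
  obtain ⟨i1, e1⟩ := key ((2:ℝ)^(-(j:ℤ)) * μ) ((2:ℝ)^(-(j:ℤ)) * (μ + 1/2)) (by nlinarith)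
  obtain ⟨i2, e2⟩ := key ((2:ℝ)^(-(j:ℤ)) * (μ + 1/2)) ((2:ℝ)^(-(j:ℤ)) * (μ + 1)) (by nlinarith)
  rw [← e1, ← e2, ← integral_sub i1 i2]
  congr 1
  ext s
  simp only [haarFn, Set.indicator_apply, mul_sub, mul_ite, mul_one, mul_zero]

lemma norm_haarFn_le_one (j : ℕ) (μ : ℤ) (x : ℝ) : ‖haarFn j μ x‖ ≤ 1 := by
  have hd : x ∈ Set.Ico ((2:ℝ)^(-(j:ℤ)) * μ) ((2:ℝ)^(-(j:ℤ)) * (μ + 1/2)) →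
      x ∉ Set.Ico ((2:ℝ)^(-(j:ℤ)) * (μ + 1/2)) ((2:ℝ)^(-(j:ℤ)) * (μ + 1)) :=
    fun h1 h2 => absurd h1.2 (not_lt.2 h2.1)
  unfold haarFn
  simp only [Set.indicator_apply]
  split_ifs <;> simp_all

lemma haarFn_eq_zero (j : ℕ) (μ : ℤ) (x : ℝ)
    (h : x < (2:ℝ)^(-(j:ℤ)) * μ ∨ (2:ℝ)^(-(j:ℤ)) * (μ + 1) ≤ x) : haarFn j μ x = 0 := by
  have hq : (0:ℝ) < (2:ℝ)^(-(j:ℤ)) := by positivity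
  unfold haarFn
  rw [Set.indicator_of_notMem, Set.indicator_of_notMem, sub_zero]
  · rintro ⟨h1, h2⟩
    rcases h with h | h <;> nlinarith
  · rintro ⟨h1, h2⟩
    rcases h with h | h <;> nlinarith

/-- The kernel obtained by integrating a mean-zero bump over an interval is concentrated near the
endpoints of that interval. -/
lemma norm_integral_translate_le {φ : ℝ → ℂ} {δ : ℝ} (hφ : Continuous φ)
    (hs : Function.support φ ⊆ Set.Icc (-δ) δ) (h0 : ∫ t, φ t = 0) {a b : ℝ} (hab : a ≤ b)
    (u : ℝ) :
    ‖∫ y in a..b, φ (y - u)‖ ≤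
      (Set.Icc (a - δ) (a + δ)).indicator (fun _ => ∫ t, ‖φ t‖) u +
      (Set.Icc (b - δ) (b + δ)).indicator (fun _ => ∫ t, ‖φ t‖) u := by
  have hint : Integrable φ :=
    hφ.integrable_of_hasCompactSupport (hasCompactSupport_of_support_subset_Icc hs)
  have hL : 0 ≤ ∫ t, ‖φ t‖ := integral_nonneg fun _ => norm_nonneg _
  rw [intervalIntegral.integral_comp_sub_right (fun y => φ y) u]
  have hab' : a - u ≤ b - u := by linarith
  have hle : ‖∫ y in (a - u)..(b - u), φ y‖ ≤ ∫ t, ‖φ t‖ := by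
    refine (intervalIntegral.norm_integral_le_integral_norm hab').trans ?_
    rw [intervalIntegral.integral_of_le hab']
    exact setIntegral_le_integral hint.norm (Filter.Eventually.of_forall fun _ => norm_nonneg _)
  have hi : ∀ s : Set ℝ, 0 ≤ s.indicator (fun _ => ∫ t, ‖φ t‖) u :=
    fun s => Set.indicator_nonneg (fun _ _ => hL) u
  by_cases ha : u ∈ Set.Icc (a - δ) (a + δ)
  · rw [Set.indicator_of_mem ha]
    exact hle.trans (le_add_of_nonneg_right (hi _))
  by_cases hb : u ∈ Set.Icc (b - δ) (b + δ)
  · rw [Set.indicator_of_mem hb]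
    exact hle.trans (le_add_of_nonneg_left (hi _))
  suffices h : ∫ y in (a - u)..(b - u), φ y = 0 by
    rw [h, norm_zero]; exact add_nonneg (hi _) (hi _)
  by_cases hmid : a + δ < u ∧ u < b - δ
  · rw [intervalIntegral.integral_eq_integral_of_support_subset, h0]
    intro t ht
    have := hs ht
    exact ⟨by linarith [this.1], by linarith [this.2]⟩
  · have hout : u < a - δ ∨ b + δ < u := by
      simp only [Set.mem_Icc, not_and_or, not_le] at ha hb hmid
      rcases ha with ha | ha
      · exact Or.inl ha
      · rcases hb with hb | hb
        · rcases hmid with h | h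
          · exact absurd ha h
          · exact absurd hb h
        · exact Or.inr hb
    rw [← intervalIntegral.integral_zero (a := a - u) (b := b - u) (μ := volume) (E := ℂ)]
    refine intervalIntegral.integral_congr fun t ht => ?_
    rw [Set.uIcc_of_le hab'] at ht
    refine apply_eq_zero_of_lt_abs hs ?_
    rcases hout with h | h
    · exact lt_of_lt_of_le (by linarith [ht.1]) (le_abs_self t)
    · exact lt_of_lt_of_le (by linarith [ht.2]) (neg_le_abs t)

/-- Integrals of `φ * f` over intervals gain the width of `φ` when `φ` has mean zero. -/
lemma norm_integral_conv_le {φ f : ℝ → ℂ} {δ M : ℝ} (hδ : 0 ≤ δ) (hM : 0 ≤ M)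
    (hφ : Continuous φ) (hs : Function.support φ ⊆ Set.Icc (-δ) δ) (h0 : ∫ t, φ t = 0)
    (hf : Continuous f) {a b : ℝ} (hab : a ≤ b)
    (hfM : ∀ u, a - δ ≤ u → u ≤ b + δ → ‖f u‖ ≤ M) :
    ‖∫ y in a..b, conv φ f y‖ ≤ 4 * δ * M * ∫ t, ‖φ t‖ := by
  have hL : 0 ≤ ∫ t, ‖φ t‖ := integral_nonneg fun _ => norm_nonneg _
  have hconv : ∀ y ∈ Set.Icc a b,
      conv φ f y = ∫ u in Set.Icc (a - δ) (b + δ), φ (y - u) * f u := by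
    intro y hy
    rw [conv_eq_integral_sub, setIntegral_eq_integral_of_forall_compl_eq_zero]
    intro u hu
    rw [apply_eq_zero_of_lt_abs hs, zero_mul]
    by_contra! h
    rw [abs_le] at h
    exact hu ⟨by linarith [hy.1, h.2], by linarith [hy.2, h.1]⟩
  have hswap : ∫ y in a..b, conv φ f y =
      ∫ u in Set.Icc (a - δ) (b + δ), (∫ y in a..b, φ (y - u)) * f u := by
    rw [intervalIntegral.integral_of_le hab, ← integral_Icc_eq_integral_Ioc,
      setIntegral_congr_fun measurableSet_Icc hconv, integral_integral_swap]
    · refine integral_congr_ae (Filter.Eventually.of_forall fun u => ?_)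
      simp only
      rw [integral_mul_const, intervalIntegral.integral_of_le hab, integral_Icc_eq_integral_Ioc]
    · rw [Measure.prod_restrict]
      refine ContinuousOn.integrableOn_compact (isCompact_Icc.prod isCompact_Icc) ?_
      refine Continuous.continuousOn ?_
      simp only [Function.uncurry_def]
      fun_prop
  rw [hswap]
  set L := ∫ t, ‖φ t‖
  have hI : ∀ c : ℝ, Integrable ((Set.Icc (c - δ) (c + δ)).indicator (fun _ : ℝ => L)) := fun c =>
    (integrable_indicator_iff measurableSet_Icc).2 (by simp)
  have hIv : ∀ c : ℝ, ∫ u, (Set.Icc (c - δ) (c + δ)).indicator (fun _ : ℝ => L) u = 2 * δ * L := by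
    intro c
    rw [integral_indicator measurableSet_Icc]
    simp only [integral_const, smul_eq_mul, measureReal_restrict_apply_univ, Real.volume_real_Icc]
    rw [max_eq_left (by linarith)]; ring
  have hG : Integrable fun u => ((Set.Icc (a - δ) (a + δ)).indicator (fun _ : ℝ => L) u +
      (Set.Icc (b - δ) (b + δ)).indicator (fun _ : ℝ => L) u) * M :=
    ((hI a).add (hI b)).mul_const M
  calc _ ≤ ∫ u in Set.Icc (a - δ) (b + δ),
        ((Set.Icc (a - δ) (a + δ)).indicator (fun _ : ℝ => L) u +
          (Set.Icc (b - δ) (b + δ)).indicator (fun _ : ℝ => L) u) * M := by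
        refine norm_integral_le_of_norm_le hG.integrableOn ?_
        filter_upwards [ae_restrict_mem measurableSet_Icc] with u hu
        rw [norm_mul]
        have h1 := norm_integral_translate_le hφ hs h0 hab u
        exact mul_le_mul h1 (hfM u hu.1 hu.2) (norm_nonneg _) ((norm_nonneg _).trans h1)
    _ ≤ ∫ u, ((Set.Icc (a - δ) (a + δ)).indicator (fun _ : ℝ => L) u +
          (Set.Icc (b - δ) (b + δ)).indicator (fun _ : ℝ => L) u) * M := by
        refine setIntegral_le_integral hG (Filter.Eventually.of_forall fun u => ?_)
        exact mul_nonneg (add_nonneg (Set.indicator_nonneg (fun _ _ => hL) u)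
          (Set.indicator_nonneg (fun _ _ => hL) u)) hM
    _ = 4 * δ * M * L := by
        rw [integral_mul_const, integral_add (hI a) (hI b), hIv, hIv]; ring

lemma norm_integral_conv_mul_haarFn_le {φ f : ℝ → ℂ} {δ M : ℝ} (hδ : 0 ≤ δ) (hM : 0 ≤ M)
    (hφ : Continuous φ) (hs : Function.support φ ⊆ Set.Icc (-δ) δ) (h0 : ∫ t, φ t = 0)
    (hf : Continuous f) (j : ℕ) (μ : ℤ)
    (hfM : ∀ u, (2:ℝ)^(-(j:ℤ)) * μ - δ ≤ u → u ≤ (2:ℝ)^(-(j:ℤ)) * (μ + 1) + δ → ‖f u‖ ≤ M) :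
    ‖∫ y, conv φ f y * haarFn j μ y‖ ≤ 8 * δ * M * ∫ t, ‖φ t‖ := by
  have hq : (0:ℝ) < (2:ℝ)^(-(j:ℤ)) := by positivity
  rw [integral_mul_haarFn
    (continuous_conv hφ (hasCompactSupport_of_support_subset_Icc hs) hf)]
  refine (norm_sub_le _ _).trans ?_
  have h1 := norm_integral_conv_le hδ hM hφ hs h0 hf
    (a := (2:ℝ)^(-(j:ℤ)) * μ) (b := (2:ℝ)^(-(j:ℤ)) * (μ + 1/2)) (by nlinarith)
    (fun u hu1 hu2 => hfM u hu1 (by nlinarith))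
  have h2 := norm_integral_conv_le hδ hM hφ hs h0 hf
    (a := (2:ℝ)^(-(j:ℤ)) * (μ + 1/2)) (b := (2:ℝ)^(-(j:ℤ)) * (μ + 1)) (by nlinarith)
    (fun u hu1 hu2 => hfM u (by nlinarith) hu2)
  linarith

lemma norm_conv_haarFn_le_integral_norm {φ : ℝ → ℂ} (hφ : Integrable φ) (j : ℕ) (μ : ℤ) (x : ℝ) :
    ‖conv φ (haarFn j μ) x‖ ≤ ∫ t, ‖φ t‖ := by
  refine norm_integral_le_of_norm_le hφ.norm (Filter.Eventually.of_forall fun t => ?_)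
  rw [norm_mul]
  exact mul_le_of_le_one_right (norm_nonneg _) (norm_haarFn_le_one j μ _)

/-- The cancellation of the Haar function against a Lipschitz function. -/
lemma norm_conv_haarFn_le_of_lipschitz {φ : ℝ → ℂ} {K : ℝ} (hφ : Continuous φ)
    (hK : ∀ s t, ‖φ s - φ t‖ ≤ K * |s - t|) (j : ℕ) (μ : ℤ) (x : ℝ) :
    ‖conv φ (haarFn j μ) x‖ ≤ K * ((2:ℝ)^(-(j:ℤ)) / 2) ^ 2 := by
  have hq : (0:ℝ) < (2:ℝ)^(-(j:ℤ)) := by positivity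
  rw [conv_eq_integral_sub, integral_mul_haarFn (by fun_prop)]
  set q := (2:ℝ)^(-(j:ℤ))
  have hsh : ∫ s in (q * (μ + 1/2))..(q * (μ + 1)), φ (x - s) =
      ∫ s in (q * μ)..(q * (μ + 1/2)), φ (x - (s + q / 2)) := by
    rw [intervalIntegral.integral_comp_add_right (fun s => φ (x - s)) (q / 2)]
    congr 1 <;> ring
  rw [hsh, ← intervalIntegral.integral_sub
    (Continuous.intervalIntegrable (by fun_prop) _ _)
    (Continuous.intervalIntegrable (by fun_prop) _ _)]
  have := intervalIntegral.norm_integral_le_of_norm_le_const (a := q * μ) (b := q * (μ + 1/2))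
    (C := K * (q / 2)) (f := fun s => φ (x - s) - φ (x - (s + q / 2))) (fun s _ => by
      refine (hK _ _).trans_eq ?_
      rw [show x - s - (x - (s + q / 2)) = q / 2 by ring, abs_of_pos (by positivity)])
  refine this.trans_eq ?_
  rw [show q * ((μ:ℝ) + 1/2) - q * μ = q / 2 by ring, abs_of_pos (by positivity)]
  ring

lemma conv_haarFn_eq_zero {φ : ℝ → ℂ} {δ : ℝ} (hs : Function.support φ ⊆ Set.Icc (-δ) δ)
    (j : ℕ) (μ : ℤ) (x : ℝ)
    (h : x + δ < (2:ℝ)^(-(j:ℤ)) * μ ∨ (2:ℝ)^(-(j:ℤ)) * (μ + 1) < x - δ) :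
    conv φ (haarFn j μ) x = 0 := by
  refine integral_eq_zero_of_ae (Filter.Eventually.of_forall fun t => ?_)
  by_cases ht : t ∈ Set.Icc (-δ) δ
  · simp only [Pi.zero_apply]
    rw [haarFn_eq_zero, mul_zero]
    rcases h with h | h
    · left; linarith [ht.1]
    · right; linarith [ht.2]
  · have : φ t = 0 := by
      by_contra h'
      exact ht (hs h')
    simp [this]

lemma Int.card_Icc_ceil_floor_le {u v : ℝ} (huv : u ≤ v) :
    ((Finset.Icc ⌈u⌉ ⌊v⌋).card : ℝ) ≤ v - u + 1 := by
  rw [Int.card_Icc]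
  rcases le_total 0 (⌊v⌋ + 1 - ⌈u⌉) with h | h
  · have : (((⌊v⌋ + 1 - ⌈u⌉).toNat : ℤ) : ℝ) = ((⌊v⌋ + 1 - ⌈u⌉ : ℤ) : ℝ) := by
      rw [Int.toNat_of_nonneg h]
    rw [Int.cast_natCast] at this
    rw [this]
    push_cast
    linarith [Int.floor_le v, Int.le_ceil u]
  · rw [Int.toNat_of_nonpos h]
    simp only [Nat.cast_zero]
    linarith

lemma sum_le_of_finite_overlap (F : Finset ℤ) (g : ℤ → ℝ) {E u v : ℝ} (hE : 0 ≤ E) (huv : u ≤ v)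
    (hgE : ∀ μ : ℤ, u ≤ μ → μ ≤ v → g μ ≤ E) (hg0 : ∀ μ : ℤ, (μ < u ∨ v < μ) → g μ = 0) :
    ∑ μ ∈ F, g μ ≤ (v - u + 1) * E := by
  classical
  calc ∑ μ ∈ F, g μ ≤ ∑ μ ∈ F, if μ ∈ Finset.Icc ⌈u⌉ ⌊v⌋ then E else 0 := by
        refine Finset.sum_le_sum fun μ _ => ?_
        split_ifs with h
        · rw [Finset.mem_Icc, Int.ceil_le, Int.le_floor] at h
          exact hgE μ h.1 h.2
        · rw [Finset.mem_Icc, Int.ceil_le, Int.le_floor, not_and_or, not_le, not_le] at h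
          exact (hg0 μ h).le
    _ = ((F.filter (· ∈ Finset.Icc ⌈u⌉ ⌊v⌋)).card : ℝ) * E := by
        rw [← Finset.sum_filter, Finset.sum_const, nsmul_eq_mul]
    _ ≤ ((Finset.Icc ⌈u⌉ ⌊v⌋).card : ℝ) * E := by
        gcongr
        intro μ hμ
        exact (Finset.mem_filter.1 hμ).2
    _ ≤ (v - u + 1) * E := by
        gcongr
        exact Int.card_Icc_ceil_floor_le huv

lemma continuous_psiDil {ψ : ℝ → ℂ} (hψ : Continuous ψ) (k : ℕ) : Continuous (psiDil ψ k) := by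
  unfold psiDil
  fun_prop

lemma support_psiDil_subset {ψ : ℝ → ℂ}
    (hψ : Function.support ψ ⊆ Set.Icc (-(1/2) : ℝ) (1/2)) (k : ℕ) :
    Function.support (psiDil ψ k) ⊆ Set.Icc (-((2:ℝ)^(-(k:ℤ)) / 2)) ((2:ℝ)^(-(k:ℤ)) / 2) := by
  intro x hx
  have h : ψ ((2:ℝ)^k * x) ≠ 0 := right_ne_zero_of_mul hx
  obtain ⟨h1, h2⟩ := hψ h
  have hk : (0:ℝ) < (2:ℝ)^k := by positivity
  rw [zpow_neg, zpow_natCast]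
  constructor
  · rw [← mul_le_mul_iff_right₀ hk]
    field_simp
    linarith
  · rw [← mul_le_mul_iff_right₀ hk]
    field_simp
    linarith

lemma integral_psiDil_eq_zero {ψ : ℝ → ℂ} (hψ : ∫ x, ψ x = 0) (k : ℕ) :
    ∫ x, psiDil ψ k x = 0 := by
  unfold psiDil
  rw [integral_const_mul, Measure.integral_comp_mul_left, hψ, smul_zero, mul_zero]

lemma integral_norm_psiDil (ψ : ℝ → ℂ) (k : ℕ) : ∫ x, ‖psiDil ψ k x‖ = ∫ x, ‖ψ x‖ := by
  unfold psiDil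
  simp only [norm_mul, norm_pow, Complex.norm_ofNat]
  rw [integral_const_mul, Measure.integral_comp_mul_left (fun x => ‖ψ x‖), smul_eq_mul,
    abs_of_pos (by positivity), ← mul_assoc, mul_inv_cancel₀ (by positivity), one_mul]

lemma psiDil_lipschitz {ψ : ℝ → ℂ} {K : ℝ} (hK : ∀ s t, ‖ψ s - ψ t‖ ≤ K * |s - t|) (k : ℕ)
    (s t : ℝ) : ‖psiDil ψ k s - psiDil ψ k t‖ ≤ K * ((2:ℝ)^k) ^ 2 * |s - t| := by
  unfold psiDil
  rw [← mul_sub, norm_mul, norm_pow, Complex.norm_ofNat]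
  calc _ ≤ (2:ℝ)^k * (K * |(2:ℝ)^k * s - (2:ℝ)^k * t|) := by gcongr; exact hK _ _
    _ = _ := by
      rw [← mul_sub, abs_mul, abs_of_pos (by positivity : (0:ℝ) < 2^k)]; ring

lemma norm_le_ballSup {f : ℝ → ℂ} (hf : ∃ B : ℝ, ∀ x, ‖f x‖ ≤ B) {c x u : ℝ}
    (hu : |u - x| ≤ c) : ‖f u‖ ≤ ballSup c f x := by
  obtain ⟨B, hB⟩ := hf
  refine le_csSup ⟨B, ?_⟩ ⟨u - x, hu, by rw [add_sub_cancel]⟩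
  rintro _ ⟨y, -, rfl⟩
  exact hB _

/-- The bound for the Haar operator at scale `2 ^ (-j)`, given a uniform bound `D` for the
functions `ψ_k * h_{j,μ}`. -/
lemma norm_sum_haar_le {ψ : ℝ → ℂ} (hψ : Continuous ψ)
    (hs : Function.support ψ ⊆ Set.Icc (-(1/2) : ℝ) (1/2)) (h0 : ∫ x, ψ x = 0)
    {k j N : ℕ} (F : Finset ℤ) {f : ℝ → ℂ} (hf : Continuous f) {x c M D : ℝ} (hM : 0 ≤ M)
    (hc : (2:ℝ)^(-(k:ℤ)) / 2 + (2:ℝ)^(-(j:ℤ)) + (2:ℝ)^(-(N:ℤ)) / 2 ≤ c)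
    (hfM : ∀ u, |u - x| ≤ c → ‖f u‖ ≤ M)
    (hD : ∀ μ : ℤ, ‖conv (psiDil ψ k) (haarFn j μ) x‖ ≤ D) :
    ‖∑ μ ∈ F, (2:ℂ)^j * (∫ y : ℝ, conv (psiDil ψ N) f y * haarFn j μ y) *
      conv (psiDil ψ k) (haarFn j μ) x‖ ≤
      ((2:ℝ)^j * (2:ℝ)^(-(k:ℤ)) + 2) * ((2:ℝ)^j * (4 * (2:ℝ)^(-(N:ℤ)) * M * ∫ t, ‖ψ t‖) * D) := by
  have hL : 0 ≤ ∫ t, ‖ψ t‖ := integral_nonneg fun _ => norm_nonneg _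
  have hD0 : 0 ≤ D := (norm_nonneg _).trans (hD 0)
  have hp : (0:ℝ) < (2:ℝ)^(-(k:ℤ)) := by positivity
  have hq : (0:ℝ) < (2:ℝ)^(-(j:ℤ)) := by positivity
  have hr : (0:ℝ) < (2:ℝ)^(-(N:ℤ)) := by positivity
  have hj : (0:ℝ) < (2:ℝ)^j := by positivity
  have hjq : (2:ℝ)^j * (2:ℝ)^(-(j:ℤ)) = 1 := by
    rw [zpow_neg, zpow_natCast, mul_inv_cancel₀ hj.ne']
  set p := (2:ℝ)^(-(k:ℤ))
  set q := (2:ℝ)^(-(j:ℤ))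
  have hcancel : ∀ a : ℝ, (2:ℝ)^j * (q * a) = a := fun a => by
    rw [← mul_assoc, hjq, one_mul]
  refine (norm_sum_le _ _).trans ?_
  have key := sum_le_of_finite_overlap F
    (fun μ => ‖(2:ℂ)^j * (∫ y : ℝ, conv (psiDil ψ N) f y * haarFn j μ y) *
      conv (psiDil ψ k) (haarFn j μ) x‖)
    (E := (2:ℝ)^j * (4 * (2:ℝ)^(-(N:ℤ)) * M * ∫ t, ‖ψ t‖) * D)
    (u := (2:ℝ)^j * (x - p / 2) - 1) (v := (2:ℝ)^j * (x + p / 2))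
    (by positivity) (by nlinarith [mul_pos hj hp]) ?_ ?_
  · refine key.trans_eq ?_
    ring
  · intro μ h1 h2
    have ha : q * μ ≤ x + p / 2 := by
      rw [← mul_le_mul_iff_right₀ hj, hcancel]; exact h2
    have hb : x - p / 2 ≤ q * (μ + 1) := by
      rw [← mul_le_mul_iff_right₀ hj, hcancel]; linarith
    simp only [norm_mul, norm_pow, Complex.norm_ofNat]
    have hin := norm_integral_conv_mul_haarFn_le (by positivity) hM (continuous_psiDil hψ N)
      (support_psiDil_subset hs N) (integral_psiDil_eq_zero h0 N) hf j μ (fun u hu1 hu2 => by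
        refine hfM u (le_trans ?_ hc)
        rw [abs_le]
        constructor <;> linarith)
    rw [integral_norm_psiDil] at hin
    refine mul_le_mul (mul_le_mul_of_nonneg_left (hin.trans_eq (by ring)) hj.le) (hD μ)
      (norm_nonneg _) (by positivity)
  · intro μ h
    rw [conv_haarFn_eq_zero (support_psiDil_subset hs k), mul_zero, norm_zero]
    rcases h with h | h
    · right
      change q * (μ + 1) < x - p / 2
      rw [← mul_lt_mul_iff_right₀ hj, hcancel]; linarith
    · left
      change x + p / 2 < q * μ
      rw [← mul_lt_mul_iff_right₀ hj, hcancel]; exact h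

/-- Pointwise Peetre-maximal bounds for $T^k_{m,n}$, cases $n\ge0$. -/
theorem TOp_pointwise_bound_n_nonneg
    (ψ : ℝ → ℂ) (hψsmooth : ContDiff ℝ (⊤ : ℕ∞) ψ)
    (hψsupp : Function.support ψ ⊆ Set.Icc (-(1/2) : ℝ) (1/2))
    (hψcanc : ∫ x : ℝ, ψ x = 0) :
    ∃ C : ℝ, 0 < C ∧ ∀ (k : ℕ) (m n : ℤ), 0 ≤ (k:ℤ) + m → 0 ≤ (k:ℤ) + m + n →
      ∀ (F : Finset ℤ) (f : ℝ → ℂ), Continuous f → (∃ B : ℝ, ∀ x, ‖f x‖ ≤ B) →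
      (0 ≤ m → 0 ≤ n → ∀ x : ℝ,
        ‖TOp ψ k m n F f x‖ ≤ C * (2:ℝ)^(-m-n) * ballSup ((2:ℝ)^(2-(k:ℤ))) f x) ∧
      (m ≤ 0 → 0 ≤ n → ∀ x : ℝ,
        ‖TOp ψ k m n F f x‖ ≤ C * (2:ℝ)^(-n) * ballSup ((2:ℝ)^(2-(k:ℤ)-m)) f x) := by
  have hψ : Continuous ψ := hψsmooth.continuous
  have hcs := hasCompactSupport_of_support_subset_Icc hψsupp
  obtain ⟨K, hK⟩ : ∃ K : ℝ, 0 ≤ K ∧ ∀ s t, ‖ψ s - ψ t‖ ≤ K * |s - t| := by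
    obtain ⟨K, hK⟩ := hψsmooth.lipschitzWith_of_hasCompactSupport hcs (by simp)
    exact ⟨K, K.2, fun s t => by simpa [Real.norm_eq_abs] using hK.norm_sub_le s t⟩
  obtain ⟨hK0, hK⟩ := hK
  have hL : 0 ≤ ∫ t, ‖ψ t‖ := integral_nonneg fun _ => norm_nonneg _
  set L := ∫ t, ‖ψ t‖ with hLdef
  refine ⟨3 * L * K + 12 * L * L + 1, by positivity, ?_⟩
  intro k m n hkm hkmn F f hf hfB
  obtain ⟨j, hj⟩ := Int.eq_ofNat_of_zero_le hkm
  obtain ⟨N, hN⟩ := Int.eq_ofNat_of_zero_le hkmn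
  have hT : ∀ x, TOp ψ k m n F f x = ∑ μ ∈ F,
      (2:ℂ)^j * (∫ y : ℝ, conv (psiDil ψ N) f y * haarFn j μ y) *
      conv (psiDil ψ k) (haarFn j μ) x := by
    intro x
    unfold TOp
    rw [hN, hj]
    rfl
  obtain rfl : m = (j:ℤ) - k := by omega
  obtain rfl : n = (N:ℤ) - j := by omega
  have hM0 : ∀ c x : ℝ, 0 ≤ ballSup c f x := fun c x =>
    Real.sSup_nonneg (by rintro _ ⟨y, -, rfl⟩; exact norm_nonneg _)
  have e2 : (2:ℝ)^(2:ℤ) = 4 := by norm_num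
  have hk : (0:ℝ) < (2:ℝ)^k := by positivity
  have hjp : (0:ℝ) < (2:ℝ)^j := by positivity
  have hNp : (0:ℝ) < (2:ℝ)^N := by positivity
  constructor
  · intro hm hn x
    have hkj : (2:ℝ)^k ≤ 2^j := pow_le_pow_right₀ (by norm_num) (by omega)
    have hjN : (2:ℝ)^j ≤ 2^N := pow_le_pow_right₀ (by norm_num) (by omega)
    rw [hT]
    have hM := hM0 ((2:ℝ)^(2-(k:ℤ))) x
    refine (norm_sum_haar_le hψ hψsupp hψcanc F hf hM ?_
      (fun u hu => norm_le_ballSup hfB hu)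
      (norm_conv_haarFn_le_of_lipschitz (continuous_psiDil hψ k)
        (psiDil_lipschitz hK k) j · x)).trans ?_
    · rw [zpow_sub₀ two_ne_zero, e2]
      simp only [zpow_neg, zpow_natCast]
      have h1 := inv_anti₀ hk hkj
      have h2 := inv_anti₀ hjp hjN
      have h3 := inv_pos.2 hk
      rw [div_eq_mul_inv 4]
      linarith
    · set M := ballSup ((2:ℝ)^(2-(k:ℤ))) f x
      have e : (2:ℝ)^(-((j:ℤ)-k) - ((N:ℤ)-j)) = 2^k / 2^N := by
        rw [show -((j:ℤ)-k) - ((N:ℤ)-j) = (k:ℤ) - N by ring, zpow_sub₀ two_ne_zero]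
        simp
      rw [e]
      simp only [zpow_neg, zpow_natCast]
      have hcard : (2:ℝ)^j * (2^k)⁻¹ + 2 ≤ 3 * (2^j * (2^k)⁻¹) := by
        have : 1 ≤ (2:ℝ)^j * (2^k)⁻¹ := by rwa [← div_eq_mul_inv, one_le_div hk]
        linarith
      calc _ ≤ 3 * (2^j * ((2:ℝ)^k)⁻¹) * (2^j * (4 * ((2:ℝ)^N)⁻¹ * M * L) *
            (K * (2^k)^2 * (((2:ℝ)^j)⁻¹ / 2)^2)) := by gcongr
        _ = (3 * L * K) * (2^k / 2^N) * M := by field_simp; ring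
        _ ≤ _ := by
          gcongr
          nlinarith
  · intro hm hn x
    have hkj : (2:ℝ)^j ≤ 2^k := pow_le_pow_right₀ (by norm_num) (by omega)
    have hjN : (2:ℝ)^j ≤ 2^N := pow_le_pow_right₀ (by norm_num) (by omega)
    rw [hT]
    have hM := hM0 ((2:ℝ)^(2-(k:ℤ)-((j:ℤ)-k))) x
    refine (norm_sum_haar_le hψ hψsupp hψcanc F hf hM ?_
      (fun u hu => norm_le_ballSup hfB hu)
      (norm_conv_haarFn_le_integral_norm ((continuous_psiDil hψ k).integrable_of_hasCompactSupport
        (hasCompactSupport_of_support_subset_Icc (support_psiDil_subset hψsupp k))) j · x)).trans ?_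
    · rw [show 2-(k:ℤ)-((j:ℤ)-k) = 2 - (j:ℤ) by ring, zpow_sub₀ two_ne_zero, e2]
      simp only [zpow_neg, zpow_natCast]
      have h1 := inv_anti₀ hjp hkj
      have h2 := inv_anti₀ hjp hjN
      have h3 := inv_pos.2 hjp
      rw [div_eq_mul_inv 4]
      linarith
    · rw [integral_norm_psiDil]
      set M := ballSup ((2:ℝ)^(2-(k:ℤ)-((j:ℤ)-k))) f x
      have e : (2:ℝ)^(-((N:ℤ)-j)) = 2^j / 2^N := by
        rw [neg_sub, zpow_sub₀ two_ne_zero]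
        simp
      rw [e]
      simp only [zpow_neg, zpow_natCast]
      have hcard : (2:ℝ)^j * (2^k)⁻¹ + 2 ≤ 3 := by
        have : (2:ℝ)^j * (2^k)⁻¹ ≤ 1 := by rwa [← div_eq_mul_inv, div_le_one hk]
        linarith
      calc _ ≤ 3 * (2^j * (4 * ((2:ℝ)^N)⁻¹ * M * L) * L) := by gcongr
        _ = (12 * L * L) * (2^j / 2^N) * M := by field_simp; ring
        _ ≤ _ := by
          gcongr
          nlinarith [mul_nonneg hL hK0]
end
end

section
/- Let 1 ≤ q ≤ p < ∞. There exists a constant C (depending only on p and q) with the following property. Let m ≥ 0 be an integer and let L be a finite set of integers with l ≥ m for every l ∈ L and #L ≥ 2^m. For each l ∈ L let P_l be a finite subset of [0,1] such that any two distinct points of P_l differ by at least 2^{m−l}, and set G_l = ∑_{x ∈ P_l} 𝟙_{[x, x + 2^{−l})}. Then ‖ (∑_{l∈L} G_l^q)^{1/q} ‖_{L^p(ℝ)} ≤ C · (2^{−m} · #L)^{1/q}. -/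
open MeasureTheory Real
open scoped ENNReal

noncomputable section

/-- $G_l=\sum_{x\in P}\mathbf 1_{[x,x+2^{-l})}$. -/
def indSum (P : Finset ℝ) (l : ℤ) : ℝ → ℝ := fun y =>
  ∑ x ∈ P, (Set.Ico x (x + (2:ℝ)^(-l))).indicator (fun _ => (1:ℝ)) y

/-- A `d`-separated finite subset of an interval of length `w` has at most `w / d + 1` points. -/
lemma card_mul_le_of_separated (S : Finset ℝ) (c w d : ℝ) (hd : 0 < d) (hw : 0 ≤ w)
    (hS : ∀ x ∈ S, c ≤ x ∧ x ≤ c + w)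
    (hsep : ∀ x ∈ S, ∀ y ∈ S, x ≠ y → d ≤ |x - y|) :
    (S.card : ℝ) * d ≤ w + d := by
  have hdisj : (S : Set ℝ).PairwiseDisjoint fun x => Set.Ico x (x + d) := by
    intro x hx y hy hxy
    refine Set.disjoint_left.2 fun z hzx hzy => ?_
    have h := hsep x hx y hy hxy
    have h' : |x - y| < d := abs_sub_lt_iff.2 ⟨by linarith [hzx.1, hzy.2, hzx.2, hzy.1],
      by linarith [hzx.1, hzy.2, hzx.2, hzy.1]⟩
    linarith
  have hvol : volume (⋃ x ∈ S, Set.Ico x (x + d)) = S.card * ENNReal.ofReal d := by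
    rw [measure_biUnion_finset hdisj fun _ _ => measurableSet_Ico]
    simp
  have hsub : (⋃ x ∈ S, Set.Ico x (x + d)) ⊆ Set.Ico c (c + w + d) := by
    refine Set.iUnion₂_subset fun x hx z hz => ⟨?_, ?_⟩
    · linarith [(hS x hx).1, hz.1]
    · linarith [(hS x hx).2, hz.2]
  have hle := measure_mono (μ := volume) hsub
  rw [hvol, Real.volume_Ico, ← ENNReal.ofReal_natCast, ← ENNReal.ofReal_mul (by positivity),
    ENNReal.ofReal_le_ofReal_iff (by linarith)] at hle
  linarith

lemma sum_two_zpow_neg_le (s : Finset ℤ) (l : ℤ) (hs : ∀ j ∈ s, l ≤ j) :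
    ∑ j ∈ s, (2 : ℝ) ^ (-j) ≤ 2 * 2 ^ (-l) := by
  induction s using Finset.induction_on_min generalizing l with
  | empty => simp only [Finset.sum_empty]; positivity
  | insert a s ha ih =>
    have h₁ := ih (a + 1) fun j hj => ha j hj
    have h₂ : (2 : ℝ) ^ (-a) = 2 * 2 ^ (-(a + 1)) := by
      rw [← zpow_one_add₀ two_ne_zero]; congr 1; ring
    have h₃ : (2 : ℝ) ^ (-a) ≤ 2 ^ (-l) :=
      zpow_le_zpow_right₀ one_le_two (by linarith [hs a (Finset.mem_insert_self a s)])
    rw [Finset.sum_insert fun h => lt_irrefl _ (ha a h)]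
    linarith

lemma add_pow_succ_le (a b : ℝ≥0∞) (k : ℕ) :
    (a + b) ^ (k + 1) ≤ b ^ (k + 1) + (k + 1) * (a * (a + b) ^ k) := by
  induction k with
  | zero => simp [add_comm]
  | succ k ih =>
    calc (a + b) ^ (k + 1 + 1) = a * (a + b) ^ (k + 1) + b * (a + b) ^ (k + 1) := by ring
      _ ≤ a * (a + b) ^ (k + 1) + b * (b ^ (k + 1) + (k + 1) * (a * (a + b) ^ k)) := by gcongr
      _ = a * (a + b) ^ (k + 1) + b ^ (k + 1 + 1) + (k + 1) * (a * (b * (a + b) ^ k)) := by ring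
      _ ≤ a * (a + b) ^ (k + 1) + b ^ (k + 1 + 1)
            + (k + 1) * (a * ((a + b) * (a + b) ^ k)) := by
        gcongr
        exact le_add_self
      _ = b ^ (k + 1 + 1) + ((k + 1 : ℕ) + 1) * (a * (a + b) ^ (k + 1)) := by
        push_cast; ring

/-- A power of a sum is controlled by the sum ordered by the smallest index. -/
lemma sum_pow_succ_le (s : Finset ℤ) (g : ℤ → ℝ≥0∞) (k : ℕ) :
    (∑ l ∈ s, g l) ^ (k + 1) ≤
      (k + 1) * ∑ l ∈ s, g l * (∑ j ∈ s with l ≤ j, g j) ^ k := by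
  induction s using Finset.induction_on_min with
  | empty => simp
  | insert a s ha ih =>
    have has : a ∉ s := fun h => lt_irrefl _ (ha a h)
    have hfilter : (insert a s).filter (a ≤ ·) = insert a s :=
      Finset.filter_true_of_mem fun j hj => by
        rcases Finset.mem_insert.1 hj with rfl | hj
        · exact le_rfl
        · exact (ha j hj).le
    have hmono : ∑ l ∈ s, g l * (∑ j ∈ s with l ≤ j, g j) ^ k ≤
        ∑ l ∈ s, g l * (∑ j ∈ insert a s with l ≤ j, g j) ^ k := by
      gcongr
      exact Finset.subset_insert a s
    rw [Finset.sum_insert has, Finset.sum_insert has, hfilter, Finset.sum_insert has, mul_add,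
      add_comm (_ * _)]
    refine (add_pow_succ_le _ _ k).trans ?_
    gcongr
    exact ih.trans (by gcongr)

/-- The `ℝ≥0∞`-valued version of `indSum`. -/
def eindSum (P : Finset ℝ) (l : ℤ) (y : ℝ) : ℝ≥0∞ :=
  ∑ x ∈ P, (Set.Ico x (x + (2 : ℝ) ^ (-l))).indicator (fun _ => (1 : ℝ≥0∞)) y

lemma ofReal_indSum (P : Finset ℝ) (l : ℤ) (y : ℝ) :
    ENNReal.ofReal (indSum P l y) = eindSum P l y := by
  unfold indSum eindSum
  rw [ENNReal.ofReal_sum_of_nonneg fun x _ => Set.indicator_nonneg (fun _ _ => zero_le_one) y]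
  refine Finset.sum_congr rfl fun x _ => ?_
  by_cases h : y ∈ Set.Ico x (x + (2 : ℝ) ^ (-l)) <;> simp only [h, Set.indicator_of_mem, not_false_eq_true,
    Set.indicator_of_notMem, ENNReal.ofReal_one, ENNReal.ofReal_zero]

lemma measurable_eindSum (P : Finset ℝ) (l : ℤ) : Measurable (eindSum P l) :=
  Finset.measurable_fun_sum _ fun _ _ => measurable_const.indicator measurableSet_Ico

lemma eindSum_le_one (P : Finset ℝ) (l : ℤ) (m : ℕ)
    (hsep : ∀ x ∈ P, ∀ y ∈ P, x ≠ y → (2 : ℝ) ^ ((m : ℤ) - l) ≤ |x - y|) (y : ℝ) :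
    eindSum P l y ≤ 1 := by
  have hpow : (2 : ℝ) ^ (-l) ≤ 2 ^ ((m : ℤ) - l) :=
    zpow_le_zpow_right₀ one_le_two (by lia)
  by_cases h : ∃ x ∈ P, y ∈ Set.Ico x (x + (2 : ℝ) ^ (-l))
  · obtain ⟨x, hx, hyx⟩ := h
    unfold eindSum
    rw [Finset.sum_eq_single_of_mem x hx]
    · exact Set.indicator_le_self _ _ y
    · intro z hz hzx
      refine Set.indicator_of_notMem (fun hyz => ?_) _
      have h' : |z - x| < (2 : ℝ) ^ (-l) := abs_sub_lt_iff.2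
        ⟨by linarith [hyx.1, hyx.2, hyz.1, hyz.2], by linarith [hyx.1, hyx.2, hyz.1, hyz.2]⟩
      linarith [hsep z hz x hx hzx]
  · push Not at h
    unfold eindSum
    rw [Finset.sum_eq_zero fun x hx => Set.indicator_of_notMem (h x hx) _]
    exact zero_le_one

/-- The intervals of generation `j` that meet an interval of length `2 ^ (-l)`, where `l ≤ j`,
have total length at most `2 * 2 ^ (-l) * 2 ^ (-m) + 2 ^ (-j)`. -/
lemma card_meeting_mul_le (P : Finset ℝ) (l j : ℤ) (m : ℕ) (hlj : l ≤ j)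
    (hsep : ∀ x ∈ P, ∀ y ∈ P, x ≠ y → (2 : ℝ) ^ ((m : ℤ) - j) ≤ |x - y|) (a : ℝ) :
    ((P.filter fun x => a - 2 ^ (-j) ≤ x ∧ x ≤ a + 2 ^ (-l)).card : ℝ) * 2 ^ (-j) ≤
      2 * 2 ^ (-l) * 2 ^ (-(m : ℤ)) + 2 ^ (-j) := by
  have hpow : (2 : ℝ) ^ (-j) ≤ 2 ^ (-l) := zpow_le_zpow_right₀ one_le_two (by lia)
  have h := card_mul_le_of_separated
    (P.filter fun x => a - (2 : ℝ) ^ (-j) ≤ x ∧ x ≤ a + 2 ^ (-l)) (a - 2 ^ (-j))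
    (2 * 2 ^ (-l)) (2 ^ ((m : ℤ) - j)) (by positivity) (by positivity)
    (fun x hx => by
      have := (Finset.mem_filter.1 hx).2
      exact ⟨this.1, by linarith⟩)
    (fun x hx y hy => hsep x (Finset.mem_filter.1 hx).1 y (Finset.mem_filter.1 hy).1)
  have hj : (2 : ℝ) ^ (-j) = 2 ^ ((m : ℤ) - j) * 2 ^ (-(m : ℤ)) := by
    rw [← zpow_add₀ two_ne_zero]; congr 1; ring
  rw [hj, ← mul_assoc, ← add_mul]
  rw [hj] at h
  gcongr

lemma setLIntegral_eindSum_mul_le (P : Finset ℝ) (l j : ℤ) (a : ℝ) (h : ℝ → ℝ≥0∞)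
    (hh : Measurable h) (B : ℝ≥0∞)
    (hB : ∀ x, ∫⁻ y in Set.Ico x (x + (2 : ℝ) ^ (-j)), h y ≤ B) :
    ∫⁻ y in Set.Ico a (a + (2 : ℝ) ^ (-l)), eindSum P j y * h y ≤
      (P.filter fun x => a - (2 : ℝ) ^ (-j) ≤ x ∧ x ≤ a + 2 ^ (-l)).card * B := by
  have hmul : ∀ y, eindSum P j y * h y =
      ∑ x ∈ P, (Set.Ico x (x + (2 : ℝ) ^ (-j))).indicator h y := fun y => by
    unfold eindSum
    rw [Finset.sum_mul]
    refine Finset.sum_congr rfl fun x _ => ?_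
    by_cases hy : y ∈ Set.Ico x (x + (2 : ℝ) ^ (-j)) <;> simp only [hy, Set.indicator_of_mem,
      not_false_eq_true, Set.indicator_of_notMem, one_mul, zero_mul]
  simp_rw [hmul]
  rw [lintegral_finsetSum _ fun x _ => hh.indicator measurableSet_Ico, ← nsmul_eq_mul,
    ← Finset.sum_const, Finset.sum_filter]
  refine Finset.sum_le_sum fun x _ => ?_
  split_ifs with hx
  · refine le_trans (setLIntegral_le_lintegral _ _) ?_
    rw [lintegral_indicator measurableSet_Ico]
    exact hB x
  · refine le_of_eq ?_
    refine (setLIntegral_congr_fun measurableSet_Ico fun y hy => ?_).trans lintegral_zero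
    refine Set.indicator_of_notMem (fun hyx => hx ⟨?_, ?_⟩) _
    · linarith [hy.1, hyx.2]
    · linarith [hy.2, hyx.1]

/-- Moments of the sum over the generations `≥ l`, localised to an interval of length
`2 ^ (-l)`. -/
lemma setLIntegral_sum_eindSum_pow_le (m : ℕ) (L : Finset ℤ) (hL : 2 ^ m ≤ L.card)
    (P : ℤ → Finset ℝ)
    (hsep : ∀ l ∈ L, ∀ x ∈ P l, ∀ y ∈ P l, x ≠ y → (2 : ℝ) ^ ((m : ℤ) - l) ≤ |x - y|)
    (k : ℕ) (l : ℤ) (a : ℝ) :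
    ∫⁻ y in Set.Ico a (a + (2 : ℝ) ^ (-l)), (∑ j ∈ L with l ≤ j, eindSum (P j) j y) ^ k ≤
      ENNReal.ofReal (k.factorial * (4 * (2 ^ (-(m : ℤ)) * L.card)) ^ k * 2 ^ (-l)) := by
  induction k generalizing l a with
  | zero => simp
  | succ k ih =>
    set M : ℝ := 2 ^ (-(m : ℤ)) * L.card with hM
    have hM1 : 1 ≤ M := by
      have : (2 : ℝ) ^ m ≤ L.card := by exact_mod_cast hL
      rw [hM, zpow_neg, zpow_natCast, inv_mul_eq_div, le_div_iff₀ (by positivity)]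
      linarith
    set A : ℝ := k.factorial * (4 * M) ^ k with hA
    have hA0 : 0 ≤ A := by positivity
    have hmeas : ∀ s : Finset ℤ, Measurable fun y => (∑ j ∈ s, eindSum (P j) j y) ^ k :=
      fun s => (Finset.measurable_fun_sum _ fun j _ => measurable_eindSum (P j) j).pow_const k
    have hterm : ∀ j ∈ L.filter (l ≤ ·),
        ∫⁻ y in Set.Ico a (a + (2 : ℝ) ^ (-l)), eindSum (P j) j y *
          (∑ i ∈ L.filter (l ≤ ·) with j ≤ i, eindSum (P i) i y) ^ k ≤
        ENNReal.ofReal (A * (2 * 2 ^ (-l) * 2 ^ (-(m : ℤ)) + 2 ^ (-j))) := by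
      intro j hj
      obtain ⟨hjL, hlj⟩ := Finset.mem_filter.1 hj
      refine (setLIntegral_eindSum_mul_le (P j) l j a _ (hmeas _)
        (ENNReal.ofReal (A * 2 ^ (-j))) fun x => ?_).trans ?_
      · refine le_trans (lintegral_mono fun y => ?_) (ih j x)
        gcongr
        exact Finset.filter_subset _ _
      · rw [← ENNReal.ofReal_natCast, ← ENNReal.ofReal_mul (by positivity)]
        refine ENNReal.ofReal_le_ofReal ?_
        rw [mul_left_comm]
        exact mul_le_mul_of_nonneg_left
          (card_meeting_mul_le (P j) l j m hlj (hsep j hjL) a) hA0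
    have hsum : ∑ j ∈ L.filter (l ≤ ·), A * (2 * 2 ^ (-l) * 2 ^ (-(m : ℤ)) + (2 : ℝ) ^ (-j)) ≤
        A * (4 * M * 2 ^ (-l)) := by
      rw [← Finset.mul_sum, Finset.sum_add_distrib, Finset.sum_const, nsmul_eq_mul]
      refine mul_le_mul_of_nonneg_left ?_ hA0
      have h₁ := sum_two_zpow_neg_le (L.filter (l ≤ ·)) l fun j hj => (Finset.mem_filter.1 hj).2
      have h₂ : ((L.filter (l ≤ ·)).card : ℝ) * (2 * 2 ^ (-l) * 2 ^ (-(m : ℤ))) ≤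
          L.card * (2 * 2 ^ (-l) * 2 ^ (-(m : ℤ))) := by
        gcongr
        exact Finset.filter_subset _ _
      have h₃ : (2 : ℝ) ^ (-l) ≤ M * 2 ^ (-l) := le_mul_of_one_le_left (by positivity) hM1
      have h₄ : (L.card : ℝ) * (2 * 2 ^ (-l) * 2 ^ (-(m : ℤ))) = 2 * (M * 2 ^ (-l)) := by
        rw [hM]; ring
      linarith
    calc ∫⁻ y in Set.Ico a (a + (2 : ℝ) ^ (-l)),
          (∑ j ∈ L with l ≤ j, eindSum (P j) j y) ^ (k + 1)
        ≤ ∫⁻ y in Set.Ico a (a + (2 : ℝ) ^ (-l)), (k + 1) * ∑ j ∈ L with l ≤ j,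
            eindSum (P j) j y * (∑ i ∈ L.filter (l ≤ ·) with j ≤ i, eindSum (P i) i y) ^ k :=
          lintegral_mono fun y => sum_pow_succ_le _ (fun j => eindSum (P j) j y) k
      _ = (k + 1) * ∑ j ∈ L with l ≤ j, ∫⁻ y in Set.Ico a (a + (2 : ℝ) ^ (-l)),
            eindSum (P j) j y * (∑ i ∈ L.filter (l ≤ ·) with j ≤ i, eindSum (P i) i y) ^ k := by
          have hm : ∀ j ∈ L.filter (l ≤ ·), Measurable fun y => eindSum (P j) j y *
              (∑ i ∈ L.filter (l ≤ ·) with j ≤ i, eindSum (P i) i y) ^ k :=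
            fun j _ => (measurable_eindSum (P j) j).mul (hmeas _)
          rw [lintegral_const_mul _ (Finset.measurable_fun_sum _ hm), lintegral_finsetSum _ hm]
      _ ≤ (k + 1) * ∑ j ∈ L with l ≤ j,
            ENNReal.ofReal (A * (2 * 2 ^ (-l) * 2 ^ (-(m : ℤ)) + 2 ^ (-j))) := by
          gcongr with j hj
          exact hterm j hj
      _ = ENNReal.ofReal ((k + 1) *
            ∑ j ∈ L with l ≤ j, A * (2 * 2 ^ (-l) * 2 ^ (-(m : ℤ)) + 2 ^ (-j))) := by
          rw [ENNReal.ofReal_mul (by positivity),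
            ENNReal.ofReal_sum_of_nonneg fun j _ => by positivity]
          congr 1
          exact_mod_cast (ENNReal.ofReal_natCast (k + 1)).symm
      _ ≤ ENNReal.ofReal ((k + 1) * (A * (4 * M * 2 ^ (-l)))) := by gcongr
      _ = _ := by
          congr 1
          rw [hA, Nat.factorial_succ]
          push_cast
          ring

lemma eindSum_eq_zero_of_notMem (P : Finset ℝ) (l : ℤ) (hl : 0 ≤ l)
    (hP : ↑P ⊆ Set.Icc (0 : ℝ) 1) {y : ℝ} (hy : y ∉ Set.Ico (0 : ℝ) 2) :
    eindSum P l y = 0 := by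
  refine Finset.sum_eq_zero fun x hx => Set.indicator_of_notMem (fun hyx => hy ?_) _
  have hpow : (2 : ℝ) ^ (-l) ≤ 2 ^ (0 : ℤ) := zpow_le_zpow_right₀ one_le_two (by lia)
  rw [zpow_zero] at hpow
  have hx01 := hP hx
  exact ⟨hx01.1.trans hyx.1, by linarith [hyx.2, hx01.2]⟩

lemma rpow_le_mul_one_add_pow (t M : ℝ≥0∞) (hM : M ≠ 0) (hM' : M ≠ ∞) (r : ℝ) (hr : 0 ≤ r)
    (k : ℕ) (hk : r ≤ k) : t ^ r ≤ M ^ r * (1 + (M ^ k)⁻¹ * t ^ k) := by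
  have ht : t = M * (t / M) := (ENNReal.mul_div_cancel hM hM').symm
  have hdiv : (t / M) ^ k = (M ^ k)⁻¹ * t ^ k := by
    rw [ENNReal.div_eq_inv_mul, mul_pow, ENNReal.inv_pow]
  calc t ^ r = M ^ r * (t / M) ^ r := by rw [← ENNReal.mul_rpow_of_nonneg _ _ hr, ← ht]
    _ ≤ M ^ r * (1 + (t / M) ^ k) := by
      gcongr
      rcases le_total (t / M) 1 with h | h
      · exact (ENNReal.rpow_le_one h hr).trans le_self_add
      · rw [← ENNReal.rpow_natCast]
        exact (ENNReal.rpow_le_rpow_of_exponent_le h hk).trans le_add_self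
    _ = _ := by rw [hdiv]

/-- $L^p$ bound for square-type functions built from sparse indicator sums:
$\|(\sum_{l\in L}G_l^q)^{1/q}\|_p\le C(2^{-m}\#L)^{1/q}$. -/
theorem indicator_sum_Lp_bound
    (p q : ℝ) (hq : 1 ≤ q) (hqp : q ≤ p) :
    ∃ C : ℝ, 0 < C ∧ ∀ (m : ℕ) (L : Finset ℤ),
      (∀ l ∈ L, (m:ℤ) ≤ l) → 2^m ≤ L.card →
      ∀ P : ℤ → Finset ℝ,
      (∀ l ∈ L, ↑(P l) ⊆ Set.Icc (0:ℝ) 1) →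
      (∀ l ∈ L, ∀ x ∈ P l, ∀ y ∈ P l, x ≠ y → (2:ℝ)^((m:ℤ) - l) ≤ |x - y|) →
      (∫⁻ y : ℝ, (∑ l ∈ L, (ENNReal.ofReal (indSum (P l) l y))^q)^(p/q) ∂volume)^(1/p) ≤
        ENNReal.ofReal (C * ((2:ℝ)^(-(m:ℝ)) * (L.card : ℝ))^(1/q)) := by
  have hq0 : 0 < q := by linarith
  have hp0 : 0 < p := by linarith
  set r : ℝ := p / q with hr
  have hr0 : 0 < r := by positivity
  set k : ℕ := ⌈r⌉₊
  have hrk : r ≤ k := Nat.le_ceil r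
  set D : ℝ := 2 + k.factorial * 4 ^ k * 2 with hD
  have hD0 : 0 < D := by positivity
  refine ⟨D ^ (1 / p), by positivity, fun m L hmL hcard P hP hsep => ?_⟩
  have hpow : (2 : ℝ) ^ (-(m : ℝ)) = 2 ^ (-(m : ℤ)) := by
    rw [← Real.rpow_intCast]; norm_num
  rw [hpow]
  set M : ℝ := 2 ^ (-(m : ℤ)) * L.card with hM
  have hM0 : 0 < M := by
    have : 0 < L.card := lt_of_lt_of_le (by positivity) hcard
    positivity
  set F : ℝ → ℝ≥0∞ := fun y => ∑ l ∈ L, eindSum (P l) l y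
  have hFmeas : Measurable F :=
    Finset.measurable_fun_sum _ fun l _ => measurable_eindSum (P l) l
  have hsupp : ∀ y, y ∉ Set.Ico (0 : ℝ) 2 → F y = 0 := fun y hy =>
    Finset.sum_eq_zero fun l hl =>
      eindSum_eq_zero_of_notMem (P l) l (by have := hmL l hl; lia) (hP l hl) hy
  have hmoment : ∫⁻ y in Set.Ico (0 : ℝ) 2, F y ^ k ≤
      ENNReal.ofReal (k.factorial * (4 * M) ^ k * 2) := by
    have h := setLIntegral_sum_eindSum_pow_le m L hcard P hsep k (-1) 0
    rw [Finset.filter_true_of_mem fun l hl => by have := hmL l hl; lia] at h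
    rw [← hM] at h
    simpa only [neg_neg, zpow_one, zero_add] using h
  have hint : ∫⁻ y, (∑ l ∈ L, (ENNReal.ofReal (indSum (P l) l y)) ^ q) ^ r ≤
      ENNReal.ofReal (M ^ r * D) := by
    calc ∫⁻ y, (∑ l ∈ L, (ENNReal.ofReal (indSum (P l) l y)) ^ q) ^ r
        ≤ ∫⁻ y, F y ^ r := by
          refine lintegral_mono fun y => ENNReal.rpow_le_rpow ?_ hr0.le
          refine Finset.sum_le_sum fun l hl => ?_
          rw [ofReal_indSum]
          simpa using ENNReal.rpow_le_rpow_of_exponent_ge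
            (eindSum_le_one (P l) l m (hsep l hl) y) hq
      _ = ∫⁻ y in Set.Ico (0 : ℝ) 2, F y ^ r := by
          refine (setLIntegral_eq_of_support_subset ?_).symm
          intro y hy
          by_contra hy'
          exact hy (by simp [hsupp y hy', hr0])
      _ ≤ ∫⁻ y in Set.Ico (0 : ℝ) 2, ENNReal.ofReal M ^ r *
            (1 + (ENNReal.ofReal M ^ k)⁻¹ * F y ^ k) :=
          lintegral_mono fun y => rpow_le_mul_one_add_pow _ _
            (by simpa using hM0) ENNReal.ofReal_ne_top r hr0.le k hrk
      _ = ENNReal.ofReal M ^ r * (ENNReal.ofReal 2 + (ENNReal.ofReal M ^ k)⁻¹ *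
            ∫⁻ y in Set.Ico (0 : ℝ) 2, F y ^ k) := by
          have hm := hFmeas.pow_const k
          rw [lintegral_const_mul _ (by fun_prop), lintegral_add_left measurable_const,
            lintegral_const_mul _ hm]
          simp
      _ ≤ ENNReal.ofReal M ^ r * (ENNReal.ofReal 2 + (ENNReal.ofReal M ^ k)⁻¹ *
            ENNReal.ofReal (k.factorial * (4 * M) ^ k * 2)) := by gcongr
      _ = ENNReal.ofReal (M ^ r * D) := by
          rw [ENNReal.ofReal_rpow_of_pos hM0, ← ENNReal.ofReal_pow hM0.le,
            ← ENNReal.ofReal_inv_of_pos (by positivity), ← ENNReal.ofReal_mul (by positivity),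
            ← ENNReal.ofReal_add (by positivity) (by positivity),
            ← ENNReal.ofReal_mul (by positivity)]
          congr 2
          rw [hD, mul_pow 4 M]
          clear_value M
          field_simp
  refine (ENNReal.rpow_le_rpow hint (by positivity)).trans_eq ?_
  rw [ENNReal.ofReal_rpow_of_pos (by positivity), Real.mul_rpow (by positivity) hD0.le,
    ← Real.rpow_mul hM0.le, mul_comm]
  congr 3
  rw [hr]
  field_simp
end
end
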